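/- arXiv:2306.11295 — 4 statements merged into one kernel-verified Lean document; each statement's English description precedes it below -/
import Mathlib

section
/- Let n > 2 be a natural number. For every permutation π ∈ S_n, define the sequence w₀ = π and, for 0 ≤ k < n, w_{2k+1} = r_{n-1}(w_{2k}) and w_{2k+2} = r_n(w_{2k+1}). Then w_{2n} = w₀, the 2n permutations w₀, w₁, …, w_{2n-1} are pairwise distinct (so this walk is a cycle of length 2n in the pancake graph 𝔓_n), for each 0 ≤ k < n the permutations w_{2k} and w_{2k+1} have the same last entry in one-line notation, and the n last entries of w₀, w₂, w₄, …, w_{2n-2} are pairwise distinct (so the cycle traverses exactly one edge in each of the n copies of 𝔓_{n-1} inside 𝔓_n). -/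
/-- The function on positions reversing the first `i` positions (0-indexed: positions `0,…,i-1`). -/
def rhoFun (n i : ℕ) (j : Fin n) : Fin n :=
  if h : j.val < i ∧ i ≤ n then ⟨i - 1 - j.val, by omega⟩ else j

theorem rhoFun_involutive (n i : ℕ) : Function.Involutive (rhoFun n i) := by
  intro j
  unfold rhoFun
  by_cases h : j.val < i ∧ i ≤ n
  · simp only [dif_pos h]
    have h2 : ((⟨i - 1 - j.val, by omega⟩ : Fin n) : ℕ) < i ∧ i ≤ n :=
      ⟨by simp; omega, h.2⟩
    simp only [dif_pos h2]
    ext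
    simp
    omega
  · simp only [dif_neg h]

/-- The permutation `ρ_i` of `Fin n` reversing the first `i` positions. -/
def rho (n i : ℕ) : Equiv.Perm (Fin n) :=
  Function.Involutive.toPerm (rhoFun n i) (rhoFun_involutive n i)

/-- The walk in the pancake graph 𝔓ₙ starting at π that alternately applies the prefix
reversals r_{n-1} and r_n (so w_{2k+1} = r_{n-1}(w_{2k}) and w_{2k+2} = r_n(w_{2k+1})). -/
def pancakeBaseWalk (n : ℕ) (π : Equiv.Perm (Fin n)) : ℕ → Equiv.Perm (Fin n)
  | 0 => π
  | k + 1 => pancakeBaseWalk n π k * (if Even k then rho n (n - 1) else rho n n)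

theorem pancakeBaseWalk_odd (n : ℕ) (π : Equiv.Perm (Fin n)) (k : ℕ) :
    pancakeBaseWalk n π (2 * k + 1) = pancakeBaseWalk n π (2 * k) * rho n (n - 1) := by
  simp [pancakeBaseWalk]

theorem pancakeBaseWalk_even_succ (n : ℕ) (π : Equiv.Perm (Fin n)) (k : ℕ) :
    pancakeBaseWalk n π (2 * (k + 1)) =
      pancakeBaseWalk n π (2 * k) * rho n (n - 1) * rho n n := by
  rw [← pancakeBaseWalk_odd, show 2 * (k + 1) = 2 * k + 1 + 1 by ring, pancakeBaseWalk,
    if_neg (by simp)]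

theorem rho_apply_val (n i : ℕ) (j : Fin n) :
    (rho n i j).val = if j.val < i ∧ i ≤ n then i - 1 - j.val else j.val := by
  change (rhoFun n i j).val = _
  unfold rhoFun
  split_ifs <;> rfl

/-- After `2 * k` steps the one-line notation of `π` has been rotated cyclically by `k`. -/
theorem pancakeBaseWalk_even_apply (n : ℕ) (π : Equiv.Perm (Fin n)) (k : ℕ) (hk : k ≤ n)
    (i j : Fin n) (h : i.val + k = j.val ∨ i.val + k = j.val + n) :
    pancakeBaseWalk n π (2 * k) j = π i := by
  induction k generalizing j with
  | zero =>
    have hij : i = j := Fin.ext (by omega)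
    simp [hij, pancakeBaseWalk]
  | succ k ih =>
    rw [pancakeBaseWalk_even_succ, Equiv.Perm.mul_apply, Equiv.Perm.mul_apply]
    apply ih (by omega)
    rw [rho_apply_val, rho_apply_val]
    have hi := i.isLt
    have hj := j.isLt
    split_ifs <;> omega

theorem pancakeBaseWalk_odd_apply_last (n : ℕ) (hn : 0 < n) (π : Equiv.Perm (Fin n)) (k : ℕ) :
    pancakeBaseWalk n π (2 * k) ⟨n - 1, by omega⟩ =
      pancakeBaseWalk n π (2 * k + 1) ⟨n - 1, by omega⟩ := by
  rw [pancakeBaseWalk_odd, Equiv.Perm.mul_apply]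
  congr 1
  apply Fin.ext
  simp [rho_apply_val]

theorem pancakeBaseWalk_even_apply_last (n : ℕ) (π : Equiv.Perm (Fin n)) (k : ℕ) (hk : k < n) :
    pancakeBaseWalk n π (2 * k) ⟨n - 1, by omega⟩ = π ⟨n - 1 - k, by omega⟩ :=
  pancakeBaseWalk_even_apply n π k hk.le _ _ (Or.inl (by simp only; omega))

theorem pancakeBaseWalk_apply_last (n : ℕ) (π : Equiv.Perm (Fin n)) (j : ℕ) (hj : j < 2 * n) :
    pancakeBaseWalk n π j ⟨n - 1, by omega⟩ = π ⟨n - 1 - j / 2, by omega⟩ := by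
  rw [← pancakeBaseWalk_even_apply_last n π (j / 2) (by omega)]
  rcases Nat.even_or_odd' j with ⟨k, rfl | rfl⟩
  · simp
  · rw [← pancakeBaseWalk_odd_apply_last n (by omega)]
    simp [show (2 * k + 1) / 2 = k by omega]

theorem pancakeBaseWalk_even_ne_odd (n : ℕ) (hn : 2 < n) (π : Equiv.Perm (Fin n)) (k : ℕ) :
    pancakeBaseWalk n π (2 * k) ≠ pancakeBaseWalk n π (2 * k + 1) := by
  intro h
  rw [pancakeBaseWalk_odd, left_eq_mul] at h
  have h0 := rho_apply_val n (n - 1) ⟨0, by omega⟩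
  rw [h, if_pos (by simp only; omega)] at h0
  simp only [Equiv.Perm.coe_one, id_eq] at h0
  omega

/-- For n > 2, the walk (r_{n-1}r_n)ⁿ starting at any π ∈ Sₙ is a cycle of length 2n in 𝔓ₙ:
it returns to π after 2n steps, its first 2n vertices are pairwise distinct, each r_{n-1}-edge
keeps the last entry of the one-line notation fixed, and the n last entries occurring along the
cycle are pairwise distinct (so the cycle meets each of the n copies of 𝔓_{n-1} in exactly
one edge). -/
theorem pancake_base_cycle (n : ℕ) (hn : 2 < n) (π : Equiv.Perm (Fin n)) :
    pancakeBaseWalk n π (2 * n) = π ∧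
    (∀ j < 2 * n, ∀ j' < 2 * n, j ≠ j' → pancakeBaseWalk n π j ≠ pancakeBaseWalk n π j') ∧
    (∀ k < n, pancakeBaseWalk n π (2 * k) ⟨n - 1, by omega⟩
      = pancakeBaseWalk n π (2 * k + 1) ⟨n - 1, by omega⟩) ∧
    (∀ k < n, ∀ k' < n, k ≠ k' →
      pancakeBaseWalk n π (2 * k) ⟨n - 1, by omega⟩
        ≠ pancakeBaseWalk n π (2 * k') ⟨n - 1, by omega⟩) := by
  refine ⟨?_, ?_, fun k _ => pancakeBaseWalk_odd_apply_last n (by omega) π k, ?_⟩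
  · ext j
    rw [pancakeBaseWalk_even_apply n π n le_rfl j j (Or.inr rfl)]
  · intro j hj j' hj' hne h
    have hlast := DFunLike.congr_fun h ⟨n - 1, by omega⟩
    rw [pancakeBaseWalk_apply_last n π j hj, pancakeBaseWalk_apply_last n π j' hj',
      π.injective.eq_iff, Fin.mk.injEq] at hlast
    rcases Nat.even_or_odd' j with ⟨k, rfl | rfl⟩ <;>
      rcases Nat.even_or_odd' j' with ⟨k', rfl | rfl⟩
    · omega
    · obtain rfl : k = k' := by omega
      exact pancakeBaseWalk_even_ne_odd n hn π k h
    · obtain rfl : k = k' := by omega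
      exact pancakeBaseWalk_even_ne_odd n hn π k h.symm
    · omega
  · intro k hk k' hk' hne h
    rw [pancakeBaseWalk_even_apply_last n π k hk, pancakeBaseWalk_even_apply_last n π k' hk',
      π.injective.eq_iff, Fin.mk.injEq] at h
    omega
end

section
/- Let n > 1 be a natural number. For every signed permutation v ∈ B_n, define the sequence w₀ = v and, for 0 ≤ k < 2n, w_{2k+1} = r_{n-1}(w_{2k}) and w_{2k+2} = r_n(w_{2k+1}). Then w_{4n} = w₀, the 4n signed permutations w₀, w₁, …, w_{4n-1} are pairwise distinct (so this walk is a cycle of length 4n in the burnt pancake graph 𝔹𝔓_n), for each 0 ≤ k < 2n the signed permutations w_{2k} and w_{2k+1} have the same last signed symbol (same last symbol with the same sign), and the 2n last signed symbols of w₀, w₂, w₄, …, w_{4n-2} are pairwise distinct (so the cycle traverses exactly one edge in each of the 2n copies of 𝔹𝔓_{n-1} inside 𝔹𝔓_n). -/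
/-- The generalized symmetric group S(m,n) = C_m ≀ S_n, modeled as pairs (π, s) where
π is the underlying permutation of symbols and s assigns a sign in ZMod m to each position. -/
abbrev GenSym (m n : ℕ) := Equiv.Perm (Fin n) × (Fin n → ZMod m)

/-- The flip (generalized prefix reversal) r_i : S(m,n) → S(m,n), reversing the first i
entries of the one-line notation and adding 1 (mod m) to each of their signs. -/
def pflip (m n i : ℕ) (v : GenSym m n) : GenSym m n :=
  (v.1 * rho n i, fun j => if j.val < i then v.2 (rho n i j) + 1 else v.2 j)

/-- The flop (inverse generalized prefix reversal) r_i⁻¹ : S(m,n) → S(m,n), reversing the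
first i entries of the one-line notation and subtracting 1 (mod m) from each of their signs;
it is the inverse bijection of the flip `pflip m n i`. -/
def flop (m n i : ℕ) (v : GenSym m n) : GenSym m n :=
  (v.1 * rho n i, fun j => if j.val < i then v.2 (rho n i j) - 1 else v.2 j)

/-- The walk in the burnt pancake graph 𝔹𝔓ₙ starting at v that alternately applies the
signed prefix reversals r_{n-1} and r_n (so w_{2k+1} = r_{n-1}(w_{2k}) and
w_{2k+2} = r_n(w_{2k+1})). -/
def burntBaseWalk (n : ℕ) (v : GenSym 2 n) : ℕ → GenSym 2 n
  | 0 => v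
  | k + 1 => pflip 2 n (if Even k then n - 1 else n) (burntBaseWalk n v k)

theorem rho_val {n i : ℕ} (hi : i ≤ n) (j : Fin n) :
    (rho n i j).val = if j.val < i then i - 1 - j.val else j.val := by
  change (rhoFun n i j).val = _
  unfold rhoFun
  by_cases h : j.val < i <;> simp [h, hi]

theorem burntBaseWalk_odd (n : ℕ) (v : GenSym 2 n) (k : ℕ) :
    burntBaseWalk n v (2 * k + 1) = pflip 2 n (n - 1) (burntBaseWalk n v (2 * k)) := by
  simp [burntBaseWalk]

theorem burntBaseWalk_two_mul_succ (n : ℕ) (v : GenSym 2 n) (k : ℕ) :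
    burntBaseWalk n v (2 * (k + 1)) =
      pflip 2 n n (pflip 2 n (n - 1) (burntBaseWalk n v (2 * k))) := by
  rw [show 2 * (k + 1) = 2 * k + 1 + 1 by ring, burntBaseWalk,
    if_neg (by simp), burntBaseWalk_odd]

/-- The signed symbol of `v` at position `p`. -/
def signedEntry {m n : ℕ} (v : GenSym m n) (p : Fin n) : Fin n × ZMod m := (v.1 p, v.2 p)

theorem signedEntry_pflip_of_lt {m n i : ℕ} (v : GenSym m n) {p : Fin n} (hp : p.val < i) :
    signedEntry (pflip m n i v) p =
      ((signedEntry v (rho n i p)).1, (signedEntry v (rho n i p)).2 + 1) := by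
  simp [signedEntry, pflip, hp]

theorem signedEntry_pflip_of_le {m n i : ℕ} (hi : i ≤ n) (v : GenSym m n) {p : Fin n}
    (hp : i ≤ p.val) : signedEntry (pflip m n i v) p = signedEntry v p := by
  have h : rho n i p = p := Fin.ext (by rw [rho_val hi, if_neg (by omega)])
  simp [signedEntry, pflip, h, not_lt.mpr hp]

theorem pflip_ne_self {m n i : ℕ} (hm : 1 < m) (hi : 0 < i) (hin : i ≤ n) (v : GenSym m n) :
    pflip m n i v ≠ v := by
  intro h
  have : Fact (1 < m) := ⟨hm⟩
  have hE := signedEntry_pflip_of_lt v (i := i) (p := ⟨0, by omega⟩) hi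
  rw [h] at hE
  simp only [signedEntry, Prod.mk.injEq] at hE
  have hrho := v.1.injective hE.1
  rw [← hrho] at hE
  simpa using hE.2

/-- Flipping the first `n - 1` and then all `n` entries moves every entry but the last one
one place to the right. -/
theorem signedEntry_pflip_pflip_succ {n : ℕ} (w : GenSym 2 n) {p : ℕ} (hp : p + 1 < n) :
    signedEntry (pflip 2 n n (pflip 2 n (n - 1) w)) ⟨p + 1, hp⟩ =
      signedEntry w ⟨p, by omega⟩ := by
  have h₁ : rho n n ⟨p + 1, hp⟩ = ⟨n - 1 - (p + 1), by omega⟩ :=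
    Fin.ext (by rw [rho_val le_rfl, if_pos hp])
  have h₂ : rho n (n - 1) ⟨n - 1 - (p + 1), by omega⟩ = ⟨p, by omega⟩ :=
    Fin.ext (by rw [rho_val (by omega), if_pos (by simp; omega)]; simp; omega)
  rw [signedEntry_pflip_of_lt _ (by exact hp), h₁,
    signedEntry_pflip_of_lt _ (by simp; omega), h₂]
  ext1
  · rfl
  · dsimp only
    rw [add_assoc, CharTwo.add_self_eq_zero, add_zero]

/-- Flipping the first `n - 1` and then all `n` entries moves the last entry to the front
and changes its sign. -/
theorem signedEntry_pflip_pflip_zero {n : ℕ} (hn : 0 < n) (w : GenSym 2 n) :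
    signedEntry (pflip 2 n n (pflip 2 n (n - 1) w)) ⟨0, hn⟩ =
      ((signedEntry w ⟨n - 1, by omega⟩).1, (signedEntry w ⟨n - 1, by omega⟩).2 + 1) := by
  have h : rho n n ⟨0, hn⟩ = ⟨n - 1, by omega⟩ :=
    Fin.ext (by rw [rho_val le_rfl, if_pos hn]; simp)
  rw [signedEntry_pflip_of_lt _ (by exact hn), h,
    signedEntry_pflip_of_le (by omega) _ (by simp)]

/-- The signed string `v` extended to all of `ℕ`, changing sign with every period `n`. -/
def cyclicEntry {n : ℕ} (hn : 0 < n) (v : GenSym 2 n) (t : ℕ) : Fin n × ZMod 2 :=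
  (v.1 ⟨t % n, Nat.mod_lt t hn⟩, v.2 ⟨t % n, Nat.mod_lt t hn⟩ + (t / n : ℕ))

theorem cyclicEntry_of_lt {n : ℕ} (hn : 0 < n) (v : GenSym 2 n) (p : Fin n) :
    cyclicEntry hn v p = signedEntry v p := by
  simp [cyclicEntry, signedEntry, Nat.mod_eq_of_lt p.isLt, Nat.div_eq_of_lt p.isLt]

theorem cyclicEntry_add {n : ℕ} (hn : 0 < n) (v : GenSym 2 n) (t : ℕ) :
    cyclicEntry hn v (t + n) = ((cyclicEntry hn v t).1, (cyclicEntry hn v t).2 + 1) := by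
  simp [cyclicEntry, Nat.add_div_right t hn, add_assoc]

theorem cyclicEntry_add_two_mul {n : ℕ} (hn : 0 < n) (v : GenSym 2 n) (t c : ℕ) :
    cyclicEntry hn v (t + 2 * n * c) = cyclicEntry hn v t := by
  induction c with
  | zero => rfl
  | succ c ih =>
    rw [show t + 2 * n * (c + 1) = t + 2 * n * c + n + n by ring, cyclicEntry_add,
      cyclicEntry_add, ih]
    ext1
    · rfl
    · dsimp only
      rw [add_assoc, CharTwo.add_self_eq_zero, add_zero]

theorem modEq_of_cyclicEntry_eq {n : ℕ} (hn : 0 < n) (v : GenSym 2 n) {t t' : ℕ}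
    (h : cyclicEntry hn v t = cyclicEntry hn v t') : t ≡ t' [MOD 2 * n] := by
  simp only [cyclicEntry, Prod.mk.injEq] at h
  have h₁ : t % n = t' % n := congrArg Fin.val (v.1.injective h.1)
  have h₂ := h.2
  simp only [h₁] at h₂
  have h₃ : t / n % 2 = t' / n % 2 := (ZMod.natCast_eq_natCast_iff' _ _ 2).mp (add_left_cancel h₂)
  rw [Nat.ModEq, mul_comm 2 n, Nat.mod_mul, Nat.mod_mul, h₁, h₃]

theorem signedEntry_burntBaseWalk {n : ℕ} (hn : 0 < n) (v : GenSym 2 n) (k : ℕ) (p : Fin n) :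
    signedEntry (burntBaseWalk n v (2 * k)) p =
      cyclicEntry hn v (p + k * (2 * n - 1)) := by
  induction k generalizing p with
  | zero => simpa [burntBaseWalk] using (cyclicEntry_of_lt hn v p).symm
  | succ k ih =>
    rw [burntBaseWalk_two_mul_succ]
    obtain ⟨p, hp⟩ := p
    cases p with
    | zero =>
      rw [signedEntry_pflip_pflip_zero, ih, ← cyclicEntry_add]
      congr 1
      rw [add_mul]
      dsimp only
      omega
    | succ p =>
      rw [signedEntry_pflip_pflip_succ, ih, ← cyclicEntry_add_two_mul _ _ _ 1]
      congr 1
      rw [add_mul]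
      dsimp only
      omega

theorem eq_of_signedEntry_burntBaseWalk_eq {n : ℕ} (hn : 0 < n) (v : GenSym 2 n) {k k' : ℕ}
    (hk : k < 2 * n) (hk' : k' < 2 * n) (p : Fin n)
    (h : signedEntry (burntBaseWalk n v (2 * k)) p =
      signedEntry (burntBaseWalk n v (2 * k')) p) : k = k' := by
  rw [signedEntry_burntBaseWalk hn, signedEntry_burntBaseWalk hn] at h
  have h₁ := Nat.ModEq.add_left_cancel' _ (modEq_of_cyclicEntry_eq hn v h)
  have hc : Nat.gcd (2 * n) (2 * n - 1) = 1 := by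
    obtain ⟨a, ha⟩ : ∃ a, 2 * n = a + 1 := ⟨2 * n - 1, by omega⟩
    simp [ha]
  exact (Nat.ModEq.cancel_right_of_coprime hc h₁).eq_of_lt_of_lt hk hk'

theorem burntBaseWalk_four_mul {n : ℕ} (hn : 0 < n) (v : GenSym 2 n) :
    burntBaseWalk n v (4 * n) = v := by
  have h (p : Fin n) : signedEntry (burntBaseWalk n v (4 * n)) p = signedEntry v p := by
    rw [show 4 * n = 2 * (2 * n) by ring, signedEntry_burntBaseWalk hn,
      cyclicEntry_add_two_mul, cyclicEntry_of_lt]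
  exact Prod.ext (Equiv.ext fun p => congrArg Prod.fst (h p))
    (funext fun p => congrArg Prod.snd (h p))

theorem signedEntry_last_burntBaseWalk_odd {n : ℕ} (hn : 0 < n) (v : GenSym 2 n) (k : ℕ) :
    signedEntry (burntBaseWalk n v (2 * k + 1)) ⟨n - 1, by omega⟩ =
      signedEntry (burntBaseWalk n v (2 * k)) ⟨n - 1, by omega⟩ := by
  rw [burntBaseWalk_odd, signedEntry_pflip_of_le (by omega) _ (by simp)]

theorem signedEntry_last_burntBaseWalk {n : ℕ} (hn : 0 < n) (v : GenSym 2 n) (j : ℕ) :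
    signedEntry (burntBaseWalk n v j) ⟨n - 1, by omega⟩ =
      signedEntry (burntBaseWalk n v (2 * (j / 2))) ⟨n - 1, by omega⟩ := by
  obtain ⟨k, rfl | rfl⟩ := Nat.even_or_odd' j
  · simp
  · rw [signedEntry_last_burntBaseWalk_odd hn, show (2 * k + 1) / 2 = k by omega]

theorem burntBaseWalk_injOn {n : ℕ} (hn : 1 < n) (v : GenSym 2 n) :
    Set.InjOn (burntBaseWalk n v) (Set.Iio (4 * n)) := by
  intro j hj j' hj' h
  rw [Set.mem_Iio] at hj hj'
  have hlast := congrArg (signedEntry · ⟨n - 1, by omega⟩) h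
  simp only [signedEntry_last_burntBaseWalk (n := n) (by omega) v j,
    signedEntry_last_burntBaseWalk (n := n) (by omega) v j'] at hlast
  have hdiv : j / 2 = j' / 2 :=
    eq_of_signedEntry_burntBaseWalk_eq (by omega) v (by omega) (by omega) _ hlast
  have hstep (k : ℕ) : burntBaseWalk n v (2 * k + 1) ≠ burntBaseWalk n v (2 * k) := by
    rw [burntBaseWalk_odd]
    exact pflip_ne_self one_lt_two (by omega) (by omega) _
  obtain ⟨k, rfl | rfl⟩ := Nat.even_or_odd' j <;>
    obtain ⟨k', rfl | rfl⟩ := Nat.even_or_odd' j' <;>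
    obtain rfl : k = k' := by omega
  · rfl
  · exact absurd h.symm (hstep k)
  · exact absurd h (hstep k)
  · rfl

/-- For n > 1, the walk (r_{n-1}r_n)²ⁿ starting at any v ∈ Bₙ is a cycle of length 4n
in 𝔹𝔓ₙ: it returns to v after 4n steps, its first 4n vertices are pairwise distinct,
each r_{n-1}-edge keeps the last signed symbol (last symbol together with its sign) fixed,
and the 2n last signed symbols occurring along the cycle are pairwise distinct (so the
cycle meets each of the 2n copies of 𝔹𝔓_{n-1} in exactly one edge). -/
theorem burnt_base_cycle (n : ℕ) (hn : 1 < n) (v : GenSym 2 n) :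
    burntBaseWalk n v (4 * n) = v ∧
    (∀ j < 4 * n, ∀ j' < 4 * n, j ≠ j' → burntBaseWalk n v j ≠ burntBaseWalk n v j') ∧
    (∀ k < 2 * n,
      ((burntBaseWalk n v (2 * k)).1 ⟨n - 1, by omega⟩,
        (burntBaseWalk n v (2 * k)).2 ⟨n - 1, by omega⟩)
      = ((burntBaseWalk n v (2 * k + 1)).1 ⟨n - 1, by omega⟩,
          (burntBaseWalk n v (2 * k + 1)).2 ⟨n - 1, by omega⟩)) ∧
    (∀ k < 2 * n, ∀ k' < 2 * n, k ≠ k' →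
      ((burntBaseWalk n v (2 * k)).1 ⟨n - 1, by omega⟩,
        (burntBaseWalk n v (2 * k)).2 ⟨n - 1, by omega⟩)
      ≠ ((burntBaseWalk n v (2 * k')).1 ⟨n - 1, by omega⟩,
          (burntBaseWalk n v (2 * k')).2 ⟨n - 1, by omega⟩)) := by
  exact ⟨burntBaseWalk_four_mul (by omega) v,
    fun j hj j' hj' hne h => hne (burntBaseWalk_injOn hn v hj hj' h),
    fun k _ => (signedEntry_last_burntBaseWalk_odd (by omega) v k).symm,
    fun k hk k' hk' hne h =>
      hne (eq_of_signedEntry_burntBaseWalk_eq (by omega) v hk hk' _ h)⟩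
end

section
/- Let m > 2 and n > 1 be natural numbers, and let 2 ≤ i ≤ n. The flip r_i : S(m,n) → S(m,n) is a bijection whose order is m if m is even and 2m if m is odd; that is, the least positive k such that the k-fold iterate of r_i is the identity map on S(m,n) equals m when m is even and equals 2m when m is odd. -/
theorem rho_val_lt {n i : ℕ} (hi : i ≤ n) {j : Fin n} (hj : j.val < i) :
    (rho n i j).val < i := by
  simp only [rho, Function.Involutive.coe_toPerm, rhoFun, dif_pos (And.intro hj hi)]
  omega

theorem rho_sq (n i : ℕ) : rho n i ^ 2 = 1 := by
  ext j
  simp [pow_two, rho, rhoFun_involutive n i j]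

theorem rho_ne_one {n i : ℕ} (hi1 : 2 ≤ i) (hi2 : i ≤ n) : rho n i ≠ 1 := by
  intro h
  have h0 := congrArg Fin.val (Equiv.congr_fun h ⟨0, by omega⟩)
  simp only [rho, Function.Involutive.coe_toPerm, rhoFun, Equiv.Perm.coe_one, id] at h0
  rw [dif_pos ⟨by omega, hi2⟩] at h0
  simp only at h0
  omega

theorem orderOf_rho {n i : ℕ} (hi1 : 2 ≤ i) (hi2 : i ≤ n) : orderOf (rho n i) = 2 :=
  orderOf_eq_prime (rho_sq n i) (rho_ne_one hi1 hi2)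

theorem pflip_iterate {m n i : ℕ} (hi : i ≤ n) (k : ℕ) (v : GenSym m n) :
    (pflip m n i)^[k] v =
      (v.1 * rho n i ^ k,
        fun j => if j.val < i then v.2 ((rho n i ^ k) j) + k else v.2 j) := by
  induction k with
  | zero => simp
  | succ k ih =>
    rw [Function.iterate_succ_apply', ih]
    refine Prod.ext ?_ (funext fun j => ?_)
    · simp [pflip, pow_succ, mul_assoc]
    · by_cases hj : j.val < i
      · simp [pflip, hj, rho_val_lt hi hj, pow_succ, add_assoc]
      · simp [pflip, hj]

theorem pflip_iterate_eq_id_iff {m n i k : ℕ} (hi1 : 2 ≤ i) (hi2 : i ≤ n) :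
    (pflip m n i)^[k] = id ↔ 2 ∣ k ∧ m ∣ k := by
  rw [← orderOf_rho hi1 hi2, orderOf_dvd_iff_pow_eq_one, ← ZMod.natCast_eq_zero_iff]
  constructor
  · intro h
    have h0 := congrFun h (1, 0)
    rw [pflip_iterate hi2] at h0
    refine ⟨by simpa using congrArg Prod.fst h0, ?_⟩
    have h1 := congrFun (congrArg Prod.snd h0) ⟨0, by omega⟩
    simpa [show 0 < i by omega] using h1
  · rintro ⟨h, hk⟩
    funext v
    rw [pflip_iterate hi2, h, hk]
    simp

/-- For m > 2, n > 1 and 2 ≤ i ≤ n, the flip r_i : S(m,n) → S(m,n) is a bijection whose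
order is m if m is even and 2m if m is odd: the least positive k whose k-fold iterate is the
identity equals m when m is even and 2m when m is odd. -/
theorem flip_order (m n i : ℕ) (hm : 2 < m) (hn : 1 < n) (hi1 : 2 ≤ i) (hi2 : i ≤ n) :
    Function.Bijective (pflip m n i) ∧
    IsLeast {k : ℕ | 0 < k ∧ (pflip m n i)^[k] = id} (if Even m then m else 2 * m) := by
  constructor
  · have h : (pflip m n i)^[2 * m] = id :=
      (pflip_iterate_eq_id_iff hi1 hi2).2 ⟨dvd_mul_right _ _, dvd_mul_left _ _⟩
    obtain ⟨l, hl⟩ : ∃ l, 2 * m = l + 1 := ⟨2 * m - 1, by omega⟩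
    rw [hl] at h
    exact Function.bijective_iff_has_inverse.2 ⟨(pflip m n i)^[l],
      fun v => (Function.iterate_succ_apply _ l v).symm.trans (congrFun h v),
      fun v => (Function.iterate_succ_apply' _ l v).symm.trans (congrFun h v)⟩
  · simp only [pflip_iterate_eq_id_iff hi1 hi2]
    split_ifs with he
    · exact ⟨⟨by omega, he.two_dvd, dvd_rfl⟩, fun k hk => Nat.le_of_dvd hk.1 hk.2.2⟩
    · refine ⟨⟨by omega, dvd_mul_right _ _, dvd_mul_left _ _⟩, fun k hk => ?_⟩
      have hc : Nat.Coprime 2 m := Nat.coprime_two_left.2 (Nat.not_even_iff_odd.1 he)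
      exact Nat.le_of_dvd hk.1 (hc.mul_dvd_of_dvd_of_dvd hk.2.1 hk.2.2)
end

section
/- Let m ≥ 3 be a natural number. Consider the map f = r₂^{-1} ∘ r₁^{-1} on S(m,2) (first apply the flop r₁^{-1}, then the flop r₂^{-1}). Then f is a bijection whose order is 2m/3 if 3 divides m, and 2m otherwise; that is, the least positive k such that the k-fold iterate of f is the identity map on S(m,2) equals 2m/3 when 3 ∣ m and equals 2m when 3 ∤ m. -/
theorem rho_two_one : rho 2 1 = 1 := by decide

theorem rho_two_two : rho 2 2 = Equiv.swap 0 1 := by decide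

theorem flop_two_flop_one (m : ℕ) (v : GenSym m 2) :
    flop m 2 2 (flop m 2 1 v) = (v.1 * Equiv.swap 0 1, ![v.2 1 - 1, v.2 0 - 2]) := by
  refine Prod.ext ?_ ?_
  · simp [flop, rho_two_one, rho_two_two]
  · funext j
    fin_cases j
    · simp [flop, rho_two_two]
    · simp [flop, rho_two_one, rho_two_two]
      ring

theorem flop_flop_iterate_two_mul (m j : ℕ) (v : GenSym m 2) :
    (fun v : GenSym m 2 => flop m 2 2 (flop m 2 1 v))^[2 * j] v =
      (v.1, fun i => v.2 i - 3 * j) := by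
  induction j with
  | zero => simp
  | succ j ih =>
    rw [show 2 * (j + 1) = (2 * j + 1) + 1 by ring, Function.iterate_succ_apply',
      Function.iterate_succ_apply', ih]
    simp only [flop_two_flop_one]
    refine Prod.ext ?_ ?_
    · simp [mul_assoc]
    · funext i
      fin_cases i <;> simp <;> ring

theorem flop_flop_iterate_eq_id_iff (m k : ℕ) :
    (fun v : GenSym m 2 => flop m 2 2 (flop m 2 1 v))^[k] = id ↔
      ∃ j, k = 2 * j ∧ m ∣ 3 * j := by
  constructor
  · intro h
    obtain ⟨j, rfl | rfl⟩ := Nat.even_or_odd' k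
    · refine ⟨j, rfl, ?_⟩
      have h0 := congrFun h (1, 0)
      rw [flop_flop_iterate_two_mul] at h0
      have h1 := congrFun (congrArg Prod.snd h0) 0
      rw [← ZMod.natCast_eq_zero_iff]
      push_cast
      simpa using h1
    · have h0 := congrFun h (1, 0)
      rw [Function.iterate_succ_apply', flop_flop_iterate_two_mul] at h0
      simp only [flop_two_flop_one] at h0
      have h1 := congrArg Prod.fst h0
      simp at h1
  · rintro ⟨j, rfl, hj⟩
    funext v
    rw [flop_flop_iterate_two_mul]
    have h : (3 * j : ZMod m) = 0 := by
      rw [← ZMod.natCast_eq_zero_iff] at hj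
      exact_mod_cast hj
    simp [h]

/-- For m ≥ 3, the map f = r₂⁻¹ ∘ r₁⁻¹ on S(m,2) (first the flop r₁⁻¹, then the flop r₂⁻¹)
is a bijection whose order is 2m/3 if 3 divides m and 2m otherwise: the least positive k
whose k-fold iterate is the identity equals 2m/3 when 3 ∣ m and 2m when 3 ∤ m. -/
theorem flop_flop_order (m : ℕ) (hm : 3 ≤ m) :
    Function.Bijective (fun v : GenSym m 2 => flop m 2 2 (flop m 2 1 v)) ∧
    IsLeast {k : ℕ | 0 < k ∧ (fun v : GenSym m 2 => flop m 2 2 (flop m 2 1 v))^[k] = id}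
      (if 3 ∣ m then 2 * m / 3 else 2 * m) := by
  refine ⟨?_, ?_⟩
  · refine Function.bijective_iff_has_inverse.mpr
      ⟨fun v => (v.1 * Equiv.swap 0 1, ![v.2 1 + 2, v.2 0 + 1]), fun v => ?_, fun v => ?_⟩
    all_goals
      simp only [flop_two_flop_one]
      refine Prod.ext (by simp [mul_assoc]) ?_
      funext i
      fin_cases i <;> simp
  · simp only [flop_flop_iterate_eq_id_iff]
    split_ifs with h
    · obtain ⟨n, rfl⟩ := h
      refine ⟨⟨by omega, n, by omega, dvd_rfl⟩, ?_⟩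
      rintro k ⟨hk, j, rfl, hj⟩
      have := Nat.le_of_dvd (by omega) hj
      omega
    · refine ⟨⟨by omega, m, rfl, dvd_mul_left m 3⟩, ?_⟩
      rintro k ⟨hk, j, rfl, hj⟩
      have hc : Nat.Coprime m 3 := ((Nat.Prime.coprime_iff_not_dvd Nat.prime_three).mpr h).symm
      have := Nat.le_of_dvd (by omega) (hc.dvd_of_dvd_mul_left hj)
      omega
end
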